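/- arXiv:1701.04837 — 10 statements merged into one kernel-verified Lean document; each statement's English description precedes it below -/
import Mathlib

section
/- Let μ₁, …, μₙ be finite (positive) measures on a measurable space (X, Σ) and let μ = μ₁ + ⋯ + μₙ. Then for every ε > 0 there exist a finite measurable partition π of X, nonnegative real numbers α_{i,S} (for i = 1, …, n and S ∈ π), and finite measures κ₁, …, κₙ on (X, Σ) such that μᵢ(B) = Σ_{S ∈ π} α_{i,S} · μ(B ∩ S) + κᵢ(B) for every B ∈ Σ and every i, and κ₁(X) + ⋯ + κₙ(X) < ε. -/
open MeasureTheory Filter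
open scoped ENNReal NNReal

/-- A measurable function of finite integral is approximated from below in `L¹`
by nonnegative simple functions. -/
lemma exists_simpleFunc_le_lintegral_sub_lt {X : Type*} [MeasurableSpace X] {μ : Measure X}
    {f : X → ℝ≥0∞} (hf : ∫⁻ x, f x ∂μ ≠ ∞) {δ : ℝ≥0∞} (hδ : δ ≠ 0) :
    ∃ φ : SimpleFunc X ℝ≥0, (∀ x, (φ x : ℝ≥0∞) ≤ f x) ∧ ∫⁻ x, (f x - φ x) ∂μ < δ := by
  have key : ∃ φ : SimpleFunc X ℝ≥0, (∀ x, (φ x : ℝ≥0∞) ≤ f x) ∧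
      ∫⁻ x, f x ∂μ < ∫⁻ x, (φ x : ℝ≥0∞) ∂μ + δ := by
    by_cases h0 : ∫⁻ x, f x ∂μ = 0
    · exact ⟨0, by simp, by simpa [h0] using pos_iff_ne_zero.2 hδ⟩
    · have h := ENNReal.sub_lt_self hf h0 hδ
      conv_rhs at h => rw [lintegral_eq_nnreal]
      obtain ⟨φ, hφ⟩ := lt_iSup_iff.1 h
      obtain ⟨hle, hφ⟩ := lt_iSup_iff.1 hφ
      refine ⟨φ, hle, ?_⟩
      rw [← SimpleFunc.lintegral_eq_lintegral] at hφ
      exact ENNReal.lt_add_of_sub_lt_right (.inl hf) hφ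
  obtain ⟨φ, hle, hlt⟩ := key
  have hm : Measurable fun x ↦ (φ x : ℝ≥0∞) := φ.measurable.coe_nnreal_ennreal
  have hφ : ∫⁻ x, (φ x : ℝ≥0∞) ∂μ ≠ ∞ := ne_top_of_le_ne_top hf (lintegral_mono hle)
  refine ⟨φ, hle, ?_⟩
  rw [lintegral_sub hm hφ (Eventually.of_forall hle)]
  exact ENNReal.sub_lt_of_lt_add (lintegral_mono hle) (by rwa [add_comm])

/-- Let `μ₁, …, μₙ` be finite positive measures on a measurable space `X`
and let `μ = μ₁ + ⋯ + μₙ`.  Then for every `ε > 0` there exist a finite measurable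
partition `S₁, …, S_N` of `X`, nonnegative coefficients `α i j` and finite measures
`κ₁, …, κₙ` such that `μᵢ(B) = ∑ⱼ α i j * μ(B ∩ Sⱼ) + κᵢ(B)` for every measurable `B`
and every `i`, and `κ₁(X) + ⋯ + κₙ(X) < ε`. -/
theorem stmt0 {X : Type*} [MeasurableSpace X] (n : ℕ) (μi : Fin n → Measure X)
    (hfin : ∀ i, IsFiniteMeasure (μi i)) (μ : Measure X) (hμ : μ = ∑ i, μi i)
    (ε : ℝ≥0∞) (hε : 0 < ε) :
    ∃ (N : ℕ) (S : Fin N → Set X),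
      (∀ j, MeasurableSet (S j)) ∧
      Pairwise (Function.onFun Disjoint S) ∧
      (⋃ j, S j) = Set.univ ∧
      ∃ (α : Fin n → Fin N → ℝ≥0) (κ : Fin n → Measure X),
        (∀ i, IsFiniteMeasure (κ i)) ∧
        (∀ i, ∀ B : Set X, MeasurableSet B →
          μi i B = (∑ j, (α i j : ℝ≥0∞) * μ (B ∩ S j)) + κ i B) ∧
        ∑ i, κ i Set.univ < ε := by
  have hμfin : IsFiniteMeasure μ := by rw [hμ]; infer_instance
  have hac (i : Fin n) : μi i ≪ μ :=
    Measure.absolutelyContinuous_of_le (hμ ▸ Finset.single_le_sum (fun _ _ ↦ Measure.zero_le _)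
      (Finset.mem_univ i))
  have hf (i : Fin n) : ∫⁻ x, (μi i).rnDeriv μ x ∂μ ≠ ∞ :=
    (Measure.lintegral_rnDeriv_lt_top _ _).ne
  obtain ⟨δ, hδ, hδε⟩ := ENNReal.exists_pos_sum_of_countable hε.ne' (Fin n)
  choose φ hle hlt using fun i ↦
    exists_simpleFunc_le_lintegral_sub_lt (hf i) (ENNReal.coe_ne_zero.2 (hδ i).ne')
  let Φ : X → Fin n → ℝ≥0 := fun x i ↦ φ i x
  have hΦ : Measurable Φ := measurable_pi_lambda _ fun i ↦ (φ i).measurable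
  have hΦfin : (Set.range Φ).Finite :=
    (Set.Finite.pi' fun i ↦ (φ i).finite_range).subset (by
      rintro _ ⟨x, rfl⟩ i
      exact ⟨x, rfl⟩)
  have := hΦfin.to_subtype
  let e := Finite.equivFin (Set.range Φ)
  let S : Fin (Nat.card (Set.range Φ)) → Set X := fun j ↦ Φ ⁻¹' {(e.symm j).1}
  have hS (j) : MeasurableSet (S j) := hΦ (measurableSet_singleton _)
  have hmem (x j) : x ∈ S j ↔ j = e ⟨Φ x, x, rfl⟩ := by
    rw [← e.symm_apply_eq, Subtype.ext_iff]
    exact eq_comm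
  let κ (i : Fin n) : Measure X := μ.withDensity fun x ↦ (μi i).rnDeriv μ x - φ i x
  have hκ (i : Fin n) : κ i Set.univ < δ i := by
    simpa [κ, withDensity_apply] using hlt i
  refine ⟨_, S, hS, ?_, ?_, fun i j ↦ (e.symm j).1 i, κ, fun i ↦ ?_,
    fun i B hB ↦ ?_, ?_⟩
  · intro j k hjk
    refine Set.disjoint_left.2 fun x hj hk ↦ hjk ?_
    rw [(hmem x j).1 hj, (hmem x k).1 hk]
  · exact Set.eq_univ_of_forall fun x ↦ Set.mem_iUnion.2 ⟨_, (hmem x _).2 rfl⟩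
  · exact ⟨(hκ i).trans ENNReal.coe_lt_top⟩
  · have hsum (x : X) : (φ i x : ℝ≥0∞) = ∑ j, (S j).indicator
        (fun _ ↦ (((e.symm j).1 i : ℝ≥0) : ℝ≥0∞)) x := by
      rw [Finset.sum_eq_single (e ⟨Φ x, x, rfl⟩)]
      · rw [Set.indicator_of_mem ((hmem x _).2 rfl), e.symm_apply_apply]
      · exact fun j _ hj ↦ Set.indicator_of_notMem (fun h ↦ hj ((hmem x j).1 h)) _
      · exact fun h ↦ absurd (Finset.mem_univ _) h
    have hφ : ∫⁻ x in B, (φ i x : ℝ≥0∞) ∂μ =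
        ∑ j, (((e.symm j).1 i : ℝ≥0) : ℝ≥0∞) * μ (B ∩ S j) := by
      simp_rw [hsum]
      rw [lintegral_finsetSum _ fun j _ ↦ measurable_const.indicator (hS j)]
      refine Finset.sum_congr rfl fun j _ ↦ ?_
      rw [lintegral_indicator_const (hS j), Measure.restrict_apply (hS j), Set.inter_comm]
    rw [← hφ, withDensity_apply _ hB, ← lintegral_add_left (φ i).measurable.coe_nnreal_ennreal,
      ← Measure.setLIntegral_rnDeriv (hac i)]
    exact lintegral_congr fun x ↦ (add_tsub_cancel_of_le (hle i x)).symm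
  · rw [tsum_fintype] at hδε
    exact (Finset.sum_le_sum fun i _ ↦ (hκ i).le).trans_lt hδε
end

section
/- Let X be a nonempty set, R a ring of subsets of X, E a Banach space, and μ : R → E a σ-additive set function of bounded variation. Then the variation |μ| is σ-additive on R: for any sequence of pairwise disjoint sets A₁, A₂, … ∈ R with A = ⋃_{n=1}^∞ Aₙ ∈ R, one has |μ|(A) = Σ_{n=1}^∞ |μ|(Aₙ). -/
open MeasureTheory Filter
open scoped ENNReal NNReal

/-- A ring of subsets of `X`: a nonempty collection closed under unions and differences. -/
structure IsRingOfSets {X : Type*} (R : Set (Set X)) : Prop where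
  nonempty : R.Nonempty
  union_mem : ∀ ⦃A B : Set X⦄, A ∈ R → B ∈ R → A ∪ B ∈ R
  diff_mem : ∀ ⦃A B : Set X⦄, A ∈ R → B ∈ R → A \ B ∈ R

/-- The variation `|μ|` of a set function `μ : Set X → E`, relative to a collection `R`. -/
noncomputable def variation {X E : Type*} [NormedAddCommGroup E]
    (R : Set (Set X)) (μ : Set X → E) (A : Set X) : ℝ≥0∞ :=
  ⨆ π : {π : Finset (Set X) // ↑π ⊆ R ∧ (π : Set (Set X)).PairwiseDisjoint id ∧ ⋃₀ ↑π = A},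
    ∑ B ∈ π.1, (‖μ B‖₊ : ℝ≥0∞)

/-- `μ` is σ-additive on `R`: for each sequence of pairwise disjoint members of `R` whose
union is in `R`, the series of values converges to the value of the union. -/
def SigmaAdditiveOn {X E : Type*} [AddCommMonoid E] [TopologicalSpace E]
    (R : Set (Set X)) (μ : Set X → E) : Prop :=
  ∀ A : ℕ → Set X, (∀ n, A n ∈ R) → Pairwise (Function.onFun Disjoint A) →
    (⋃ n, A n) ∈ R →
    Tendsto (fun N => ∑ n ∈ Finset.range N, μ (A n)) atTop (nhds (μ (⋃ n, A n)))

namespace IsRingOfSets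

variable {X : Type*} {R : Set (Set X)}

theorem empty_mem (hR : IsRingOfSets R) : ∅ ∈ R := by
  obtain ⟨A, hA⟩ := hR.nonempty
  simpa using hR.diff_mem hA hA

theorem inter_mem (hR : IsRingOfSets R) {A B : Set X} (hA : A ∈ R) (hB : B ∈ R) : A ∩ B ∈ R := by
  simpa using hR.diff_mem hA (hR.diff_mem hA hB)

theorem biUnion_mem {ι : Type*} (hR : IsRingOfSets R) (s : Finset ι) {A : ι → Set X}
    (hA : ∀ i ∈ s, A i ∈ R) : (⋃ i ∈ s, A i) ∈ R := by
  classical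
  induction s using Finset.induction_on with
  | empty => simpa using hR.empty_mem
  | insert i s _ ih =>
    rw [Finset.set_biUnion_insert]
    exact hR.union_mem (hA i (s.mem_insert_self i))
      (ih fun j hj => hA j (Finset.mem_insert_of_mem hj))

end IsRingOfSets

/-- A σ-additive set function on a ring vanishes at the empty set. -/
theorem SigmaAdditiveOn.map_empty {X E : Type*} [NormedAddCommGroup E] {R : Set (Set X)}
    {μ : Set X → E} (hμ : SigmaAdditiveOn R μ) (hR : IsRingOfSets R) : μ ∅ = 0 := by
  have h := hμ (fun _ => ∅) (fun _ => hR.empty_mem) (fun _ _ _ => disjoint_bot_left)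
    (by simpa using hR.empty_mem)
  simp only [Set.iUnion_empty] at h
  have h' := ((tendsto_add_atTop_iff_nat 1).2 h).sub h
  simp only [Finset.sum_range_succ, add_sub_cancel_left, sub_self] at h'
  exact tendsto_nhds_unique tendsto_const_nhds h'

theorem SigmaAdditiveOn.enorm_le_tsum {X E : Type*} [NormedAddCommGroup E] {R : Set (Set X)}
    {μ : Set X → E} (hμ : SigmaAdditiveOn R μ) {A : ℕ → Set X} (hA : ∀ n, A n ∈ R)
    (hd : Pairwise (Function.onFun Disjoint A)) (hU : (⋃ n, A n) ∈ R) :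
    ‖μ (⋃ n, A n)‖ₑ ≤ ∑' n, ‖μ (A n)‖ₑ :=
  le_of_tendsto (hμ A hA hd hU).enorm <| Eventually.of_forall fun _ =>
    (enorm_sum_le _ _).trans (ENNReal.sum_le_tsum _)

section Variation

variable {X E : Type*} [NormedAddCommGroup E] {R : Set (Set X)} {μ : Set X → E}

theorem sum_enorm_le_variation {ι : Type*} (h0 : μ ∅ = 0) (s : Finset ι) {f : ι → Set X}
    (hf : ∀ i ∈ s, f i ∈ R) (hd : (s : Set ι).PairwiseDisjoint f) :
    ∑ i ∈ s, ‖μ (f i)‖ₑ ≤ variation R μ (⋃ i ∈ s, f i) := by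
  classical
  refine (Finset.sum_image_of_disjoint (g := fun B => ‖μ B‖ₑ) (by simp [h0]) hd).symm.trans_le ?_
  refine le_iSup_of_le ⟨s.image f, ?_, ?_, ?_⟩ le_rfl
  · simpa [Set.subset_def] using hf
  · rw [Finset.coe_image]
    rintro _ ⟨i, hi, rfl⟩ _ ⟨j, hj, rfl⟩ hij
    exact hd hi hj (ne_of_apply_ne f hij)
  · simp

theorem variation_add_le_union (h0 : μ ∅ = 0) {A B : Set X} (hA : A ∈ R) (hB : B ∈ R)
    (hAB : Disjoint A B) : variation R μ A + variation R μ B ≤ variation R μ (A ∪ B) := by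
  have hne {C : Set X} (hC : C ∈ R) : Nonempty {π : Finset (Set X) //
      ↑π ⊆ R ∧ (π : Set (Set X)).PairwiseDisjoint id ∧ ⋃₀ ↑π = C} :=
    ⟨{C}, by simpa using hC, by simp, by simp⟩
  have := hne hA
  have := hne hB
  refine ENNReal.iSup_add_iSup_le ?_
  rintro ⟨π, hπ, hπd, rfl⟩ ⟨ρ, hρ, hρd, rfl⟩
  have hdisj {C D : Set X} (hC : C ∈ π) (hD : D ∈ ρ) : Disjoint C D :=
    hAB.mono (Set.subset_sUnion_of_mem hC) (Set.subset_sUnion_of_mem hD)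
  have h := sum_enorm_le_variation (R := R) h0 (π.disjSum ρ) (f := Sum.elim id id)
    (by
      rintro (C | C) hC
      · exact hπ (Finset.inl_mem_disjSum.1 hC)
      · exact hρ (Finset.inr_mem_disjSum.1 hC))
    (by
      rintro (C | C) hC (D | D) hD hCD <;>
        simp only [Finset.mem_coe, Finset.inl_mem_disjSum, Finset.inr_mem_disjSum] at hC hD
      · exact hπd hC hD (by simpa using hCD)
      · exact hdisj hC hD
      · exact (hdisj hD hC).symm
      · exact hρd hC hD (by simpa using hCD))
  rw [Finset.sum_disjSum] at h
  refine h.trans_eq (congrArg _ ?_)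
  ext x
  simp

theorem variation_mono (hR : IsRingOfSets R) (h0 : μ ∅ = 0) {A B : Set X} (hA : A ∈ R)
    (hB : B ∈ R) (hAB : A ⊆ B) : variation R μ A ≤ variation R μ B := by
  have h := variation_add_le_union h0 hA (hR.diff_mem hB hA) Set.disjoint_sdiff_right
  rw [Set.union_sdiff_cancel hAB] at h
  exact le_self_add.trans h

theorem sum_variation_le_biUnion {ι : Type*} (hR : IsRingOfSets R) (h0 : μ ∅ = 0) (s : Finset ι)
    {A : ι → Set X} (hA : ∀ i, A i ∈ R) (hd : Pairwise (Function.onFun Disjoint A)) :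
    ∑ i ∈ s, variation R μ (A i) ≤ variation R μ (⋃ i ∈ s, A i) := by
  classical
  induction s using Finset.induction_on with
  | empty => simp
  | insert i s hi ih =>
    rw [Finset.sum_insert hi, Finset.set_biUnion_insert]
    refine (add_le_add_right ih _).trans
      (variation_add_le_union h0 (hA i) (hR.biUnion_mem s fun j _ => hA j) ?_)
    simp only [Set.disjoint_iUnion_right]
    exact fun j hj => hd (by rintro rfl; exact hi hj)

theorem tsum_variation_le_iUnion (hR : IsRingOfSets R) (h0 : μ ∅ = 0) {A : ℕ → Set X}
    (hA : ∀ n, A n ∈ R) (hd : Pairwise (Function.onFun Disjoint A)) (hU : (⋃ n, A n) ∈ R) :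
    ∑' n, variation R μ (A n) ≤ variation R μ (⋃ n, A n) :=
  ENNReal.summable.tsum_le_of_sum_le fun s =>
    (sum_variation_le_biUnion hR h0 s hA hd).trans <|
      variation_mono hR h0 (hR.biUnion_mem s fun n _ => hA n) hU
        (Set.iUnion₂_subset fun n _ => Set.subset_iUnion A n)

theorem variation_iUnion_le_tsum (hR : IsRingOfSets R) (hμ : SigmaAdditiveOn R μ)
    {A : ℕ → Set X} (hA : ∀ n, A n ∈ R) (hd : Pairwise (Function.onFun Disjoint A)) :
    variation R μ (⋃ n, A n) ≤ ∑' n, variation R μ (A n) := by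
  refine iSup_le ?_
  rintro ⟨π, hπ, hπd, hπU⟩
  have hBU {B : Set X} (hB : B ∈ π) : ⋃ n, B ∩ A n = B := by
    rw [← Set.inter_iUnion, ← hπU]
    exact Set.inter_eq_left.2 (Set.subset_sUnion_of_mem hB)
  calc ∑ B ∈ π, ‖μ B‖ₑ ≤ ∑ B ∈ π, ∑' n, ‖μ (B ∩ A n)‖ₑ := by
        refine Finset.sum_le_sum fun B hB => ?_
        conv_lhs => rw [← hBU hB]
        refine hμ.enorm_le_tsum (fun n => hR.inter_mem (hπ hB) (hA n))
          (fun m n hmn => (hd hmn).mono Set.inter_subset_right Set.inter_subset_right) ?_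
        rw [hBU hB]
        exact hπ hB
    _ = ∑' n, ∑ B ∈ π, ‖μ (B ∩ A n)‖ₑ :=
        (Summable.tsum_finsetSum fun _ _ => ENNReal.summable).symm
    _ ≤ ∑' n, variation R μ (A n) := by
        refine ENNReal.tsum_le_tsum fun n => ?_
        refine (sum_enorm_le_variation (hμ.map_empty hR) π
          (fun B hB => hR.inter_mem (hπ hB) (hA n))
          (hπd.mono fun B => Set.inter_subset_left)).trans_eq (congrArg _ ?_)
        rw [← Set.iUnion₂_inter]
        refine Set.inter_eq_right.2 ?_
        rw [Set.sUnion_eq_biUnion] at hπU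
        exact (Set.subset_iUnion A n).trans_eq hπU.symm

end Variation

/-- If `μ : R → E` is a σ-additive set function of bounded variation on a
ring of subsets `R` of a nonempty set `X`, with values in a Banach space `E`, then the
variation `|μ|` is σ-additive on `R`. -/
theorem stmt2 {X E : Type*} [Nonempty X]
    [NormedAddCommGroup E] [NormedSpace ℝ E] [CompleteSpace E]
    (R : Set (Set X)) (hR : IsRingOfSets R)
    (μ : Set X → E)
    (hσ : SigmaAdditiveOn R μ)
    (hbv : (⨆ A ∈ R, variation R μ A) < ⊤)
    (A : ℕ → Set X) (hA : ∀ n, A n ∈ R)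
    (hdisj : Pairwise (Function.onFun Disjoint A))
    (hU : (⋃ n, A n) ∈ R) :
    variation R μ (⋃ n, A n) = ∑' n, variation R μ (A n) := by
  have h0 := hσ.map_empty hR
  exact (variation_iUnion_le_tsum hR hσ hA hdisj).antisymm
    (tsum_variation_le_iUnion hR h0 hA hdisj hU)
end

section
/- Let X be a nonempty set, R a ring of subsets of X, E a Banach space, and μ : R → E a σ-additive set function of bounded variation. Suppose S ⊆ X, Aₙ, Bₙ ∈ R, and αₙ, βₙ ∈ {−1, 1} are such that both expansions hold: Σ_{n=1}^∞ |μ|(Aₙ) < ∞ and Σ_{n=1}^∞ αₙ 1_{Aₙ}(x) = 1_S(x) for every x belonging to only finitely many Aₙ; and Σ_{n=1}^∞ |μ|(Bₙ) < ∞ and Σ_{n=1}^∞ βₙ 1_{Bₙ}(x) = 1_S(x) for every x belonging to only finitely many Bₙ. Then Σ_{n=1}^∞ αₙ μ(Aₙ) = Σ_{n=1}^∞ βₙ μ(Bₙ) (both series converging in E). -/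
open MeasureTheory Filter
open scoped ENNReal NNReal

theorem IsRingOfSets.empty_mem_s4 {X : Type*} {R : Set (Set X)} (hR : IsRingOfSets R) : ∅ ∈ R := by
  obtain ⟨A, hA⟩ := hR.nonempty
  simpa using hR.diff_mem hA hA

theorem IsRingOfSets.inter_mem_s4 {X : Type*} {R : Set (Set X)} (hR : IsRingOfSets R)
    {A B : Set X} (hA : A ∈ R) (hB : B ∈ R) : A ∩ B ∈ R := by
  simpa using hR.diff_mem hA (hR.diff_mem hA hB)

theorem IsRingOfSets.exists_superset {X ι : Type*} {R : Set (Set X)} (hR : IsRingOfSets R)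
    {C : ι → Set X} (hC : ∀ i, C i ∈ R) (s : Finset ι) : ∃ D ∈ R, ∀ i ∈ s, C i ⊆ D := by
  classical
  induction s using Finset.induction_on with
  | empty => exact ⟨∅, hR.empty_mem_s4, by simp⟩
  | insert a s _ ih =>
    obtain ⟨D, hD, hsD⟩ := ih
    refine ⟨C a ∪ D, hR.union_mem (hC a) hD, fun i hi => ?_⟩
    rcases Finset.mem_insert.1 hi with rfl | hi
    · exact Set.subset_union_left
    · exact (hsD i hi).trans Set.subset_union_right

section SigmaAdditive

variable {X E : Type*} [NormedAddCommGroup E] {R : Set (Set X)} {μ : Set X → E}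

theorem SigmaAdditiveOn.empty (hσ : SigmaAdditiveOn R μ) (hR : IsRingOfSets R) : μ ∅ = 0 := by
  have h := hσ (fun _ => ∅) (fun _ => hR.empty_mem_s4) (fun i j _ => by simp [Function.onFun])
    (by simpa using hR.empty_mem_s4)
  have h' := (h.comp (tendsto_add_atTop_nat 1)).sub h
  simp only [Function.comp_def, Finset.sum_range_succ, add_sub_cancel_left, sub_self] at h'
  exact tendsto_nhds_unique tendsto_const_nhds h'

theorem SigmaAdditiveOn.union (hσ : SigmaAdditiveOn R μ) (hR : IsRingOfSets R) {A B : Set X}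
    (hA : A ∈ R) (hB : B ∈ R) (hAB : Disjoint A B) : μ (A ∪ B) = μ A + μ B := by
  let C : ℕ → Set X := fun n => if n = 0 then A else if n = 1 then B else ∅
  have hU : ⋃ n, C n = A ∪ B := by
    ext x
    simp only [Set.mem_iUnion, Set.mem_union, C]
    constructor
    · rintro ⟨n, hn⟩
      split_ifs at hn <;> simp_all
    · rintro (h | h)
      · exact ⟨0, by simpa using h⟩
      · exact ⟨1, by simpa using h⟩
  have h := hσ C (fun n => by
      simp only [C]; split_ifs; exacts [hA, hB, hR.empty_mem_s4])
    (fun i j hij => by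
      simp only [C, Function.onFun]
      split_ifs <;> simp_all [hAB.symm])
    (hU ▸ hR.union_mem hA hB)
  rw [hU] at h
  refine tendsto_nhds_unique h (tendsto_atTop_of_eventually_const (i₀ := 2) fun N hN => ?_)
  obtain ⟨k, rfl⟩ := Nat.exists_eq_add_of_le hN
  rw [Finset.sum_range_add]
  have htail : ∀ i, C (2 + i) = ∅ := fun i => by
    simp only [C]
    rw [if_neg (by lia), if_neg (by lia)]
  simp [htail, hσ.empty hR, Finset.sum_range_succ, C]

theorem enorm_le_variation {A : Set X} (hA : A ∈ R) : ‖μ A‖ₑ ≤ variation R μ A := by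
  refine le_trans ?_ (le_iSup _ ⟨{A}, by simpa using hA, by simp, by simp⟩)
  simp [enorm_eq_nnnorm]

theorem variation_add_le_variation_union {A B : Set X} (hA : A ∈ R) (hB : B ∈ R)
    (hAB : Disjoint A B) (h0 : μ ∅ = 0) :
    variation R μ A + variation R μ B ≤ variation R μ (A ∪ B) := by
  classical
  have hne : ∀ {D : Set X}, D ∈ R → Nonempty {π : Finset (Set X) //
      ↑π ⊆ R ∧ (π : Set (Set X)).PairwiseDisjoint id ∧ ⋃₀ ↑π = D} := fun {D} hD =>
    ⟨⟨{D}, by simpa using hD, by simp, by simp⟩⟩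
  have := hne hA
  have := hne hB
  refine ENNReal.iSup_add_iSup_le ?_
  rintro ⟨π, hπ, hπd, rfl⟩ ⟨ρ, hρ, hρd, rfl⟩
  have hdisj : ∀ s ∈ π, ∀ t ∈ ρ, Disjoint s t := fun s hs t ht =>
    hAB.mono (Set.subset_sUnion_of_mem (by simpa using hs))
      (Set.subset_sUnion_of_mem (by simpa using ht))
  have hinter : ∑ s ∈ π ∩ ρ, (‖μ s‖₊ : ℝ≥0∞) = 0 := Finset.sum_eq_zero fun s hs => by
    rw [Finset.mem_inter] at hs
    have : s = ∅ := by simpa using hdisj s hs.1 s hs.2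
    simp [this, h0]
  rw [← Finset.sum_union_inter, hinter, add_zero]
  unfold variation
  refine le_iSup_of_le ⟨π ∪ ρ, ?_, ?_, ?_⟩ le_rfl
  · simpa using ⟨hπ, hρ⟩
  · rw [Finset.coe_union, Set.pairwiseDisjoint_union]
    exact ⟨hπd, hρd, fun s hs t ht _ => hdisj s hs t ht⟩
  · rw [Finset.coe_union, Set.sUnion_union]

/-- Countable subadditivity: a member of the ring covered by countably many others. -/
theorem SigmaAdditiveOn.enorm_le_tsum_variation (hσ : SigmaAdditiveOn R μ) (hR : IsRingOfSets R)
    {A : Set X} (hA : A ∈ R) {T : ℕ → Set X} (hT : ∀ n, T n ∈ R) (hAT : A ⊆ ⋃ n, T n) :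
    ‖μ A‖ₑ ≤ ∑' n, variation R μ (T n) := by
  have hdis : ∀ n, disjointed T n ∈ R := fun n =>
    disjointedRec (p := (· ∈ R)) (fun _ _ h => hR.diff_mem h (hT _)) (hT n)
  have hU : ⋃ n, A ∩ disjointed T n = A := by
    rw [← Set.inter_iUnion, iUnion_disjointed, Set.inter_eq_left.2 hAT]
  have h := hσ (fun n => A ∩ disjointed T n) (fun n => hR.inter_mem_s4 hA (hdis n))
    (fun i j hij => (disjoint_disjointed T hij).mono Set.inter_subset_right
      Set.inter_subset_right) (by rwa [hU])
  rw [hU] at h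
  refine le_of_tendsto h.enorm (Eventually.of_forall fun N => ?_)
  refine (enorm_sum_le _ _).trans (le_trans (Finset.sum_le_sum fun n _ => ?_)
    (ENNReal.sum_le_tsum (Finset.range N)))
  have hmem := hR.inter_mem_s4 hA (hdis n)
  have hsub : A ∩ disjointed T n ⊆ T n :=
    Set.inter_subset_right.trans (disjointed_subset T n)
  calc ‖μ (A ∩ disjointed T n)‖ₑ ≤ variation R μ (A ∩ disjointed T n) := enorm_le_variation hmem
    _ ≤ _ := le_self_add
    _ ≤ _ := variation_add_le_variation_union hmem (hR.diff_mem (hT n) hmem) Set.disjoint_sdiff_right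
      (hσ.empty hR)
    _ = variation R μ (T n) := by rw [Set.union_sdiff_cancel hsub]

open Classical in
/-- A σ-additive set function on a ring is dominated by a measure which is dominated by the
variation. -/
theorem SigmaAdditiveOn.exists_measure (hσ : SigmaAdditiveOn R μ) (hR : IsRingOfSets R) :
    ∃ ν : @Measure X (MeasurableSpace.generateFrom R),
      ∀ A ∈ R, ‖μ A‖ₑ ≤ ν A ∧ ν A ≤ variation R μ A := by
  let m : Set X → ℝ≥0∞ := fun A => if A ∈ R then variation R μ A else ⊤
  have hm : ∀ {A}, A ∈ R → m A = variation R μ A := fun h => if_pos h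
  have hm' : ∀ {A}, A ∉ R → m A = ⊤ := fun h => if_neg h
  have m0 : m ∅ = 0 := by
    rw [hm hR.empty_mem_s4]
    refine le_antisymm (iSup_le ?_) zero_le
    rintro ⟨π, -, -, hπ⟩
    refine (Finset.sum_eq_zero fun s hs => ?_).le
    have : s = ∅ := Set.sUnion_eq_empty.1 hπ s (by simpa using hs)
    simp [this, hσ.empty hR]
  have hcar : MeasurableSpace.generateFrom R ≤ (OuterMeasure.ofFunction m m0).caratheodory := by
    refine MeasurableSpace.generateFrom_le fun A hA => OuterMeasure.ofFunction_caratheodory ?_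
    intro T
    by_cases hT : T ∈ R
    · have h1 := hR.inter_mem_s4 hT hA
      have h2 := hR.diff_mem hT hA
      rw [hm hT, hm h1, hm h2]
      simpa [Set.inter_union_sdiff] using variation_add_le_variation_union h1 h2
        Set.disjoint_sdiff_inter.symm (hσ.empty hR)
    · simp [hm' hT]
  let _ := MeasurableSpace.generateFrom R
  refine ⟨(OuterMeasure.ofFunction m m0).toMeasure hcar, fun A hA => ?_⟩
  rw [toMeasure_apply _ _ (MeasurableSpace.measurableSet_generateFrom hA)]
  refine ⟨?_, (OuterMeasure.ofFunction_le A).trans_eq (hm hA)⟩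
  rw [OuterMeasure.ofFunction_apply]
  refine le_iInf₂ fun T hT => ?_
  by_cases h : ∀ n, T n ∈ R
  · simpa only [hm (h _)] using hσ.enorm_le_tsum_variation hR hA h hT
  · obtain ⟨n, hn⟩ := not_forall.1 h
    rw [ENNReal.tsum_eq_top_of_eq_top ⟨n, hm' hn⟩]
    exact le_top

variable [NormedSpace ℝ E]

theorem SigmaAdditiveOn.enorm_add_sum_le_lintegral {ι : Type*} (hσ : SigmaAdditiveOn R μ)
    (hR : IsRingOfSets R) [MeasurableSpace X] {ν : Measure X}
    (hRm : ∀ A ∈ R, MeasurableSet A) (hν : ∀ A ∈ R, ‖μ A‖ₑ ≤ ν A) {C : ι → Set X}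
    (hC : ∀ i, C i ∈ R) (γ : ι → ℝ) (s : Finset ι) {D : Set X} (hD : D ∈ R) (c : ℝ) :
    ‖c • μ D + ∑ i ∈ s, γ i • μ (C i ∩ D)‖ₑ ≤
      ∫⁻ x in D, ‖c + ∑ i ∈ s, (C i).indicator (fun _ => γ i) x‖ₑ ∂ν := by
  classical
  induction s using Finset.induction_on generalizing D c with
  | empty => simpa [enorm_smul] using mul_le_mul_right (hν D hD) ‖c‖ₑ
  | insert a s ha ih =>
    have h1 := hR.inter_mem_s4 hD (hC a)
    have h2 := hR.diff_mem hD (hC a)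
    have hsplit : ∀ F ∈ R, μ (F ∩ D) = μ (F ∩ (D ∩ C a)) + μ (F ∩ (D \ C a)) := by
      intro F hF
      rw [← hσ.union hR (hR.inter_mem_s4 hF h1) (hR.inter_mem_s4 hF h2)
        (Set.disjoint_sdiff_inter.symm.mono Set.inter_subset_right Set.inter_subset_right),
        ← Set.inter_union_distrib_left, Set.inter_union_sdiff]
    have hD' : μ D = μ (D ∩ C a) + μ (D \ C a) := by
      rw [← hσ.union hR h1 h2 Set.disjoint_sdiff_inter.symm, Set.inter_union_sdiff]
    have key : c • μ D + ∑ i ∈ insert a s, γ i • μ (C i ∩ D) =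
        ((c + γ a) • μ (D ∩ C a) + ∑ i ∈ s, γ i • μ (C i ∩ (D ∩ C a))) +
        (c • μ (D \ C a) + ∑ i ∈ s, γ i • μ (C i ∩ (D \ C a))) := by
      rw [Finset.sum_insert ha, Finset.sum_congr rfl fun i _ => by rw [hsplit _ (hC i)], hD',
        Set.inter_comm (C a) D]
      simp only [smul_add, add_smul, Finset.sum_add_distrib]
      abel
    rw [key, ← lintegral_inter_add_sdiff _ D (hRm _ (hC a))]
    refine (enorm_add_le _ _).trans (add_le_add ?_ ?_)
    · refine (ih h1 _).trans_eq (setLIntegral_congr_fun (hRm _ h1) fun x hx => ?_)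
      simp only [Finset.sum_insert ha, Set.indicator_of_mem hx.2, add_assoc]
    · refine (ih h2 _).trans_eq (setLIntegral_congr_fun (hRm _ h2) fun x hx => ?_)
      simp only [Finset.sum_insert ha, Set.indicator_of_notMem hx.2, zero_add]

theorem enorm_sum_indicator_le_tsum_compl {ι : Type*} {C : ι → Set X} {γ : ι → ℝ}
    (hγ : ∀ i, ‖γ i‖ₑ ≤ 1) {x : X}
    (hx : {i | x ∈ C i}.Finite → HasSum (fun i => (C i).indicator (fun _ => γ i) x) 0)
    (s : Finset ι) :
    ‖∑ i ∈ s, (C i).indicator (fun _ => γ i) x‖ₑ ≤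
      ∑' i : {i // i ∉ s}, (C i).indicator (1 : X → ℝ≥0∞) x := by
  by_cases hfin : {i | x ∈ C i}.Finite
  · have h := hx hfin
    have hs := h.summable.sum_add_tsum_subtype_compl s
    rw [h.tsum_eq] at hs
    rw [eq_neg_of_add_eq_zero_left hs, enorm_neg]
    refine enorm_tsum_le_tsum_enorm.trans (ENNReal.tsum_le_tsum fun i => ?_)
    by_cases hi : x ∈ C i <;> simp [hi, hγ]
  · suffices h : ∑' i : {i // i ∉ s}, (C i).indicator (1 : X → ℝ≥0∞) x = ⊤ from h ▸ le_top
    by_contra hne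
    refine hfin ((((ENNReal.finite_const_le_of_tsum_ne_top hne one_ne_zero).image
      Subtype.val).union s.finite_toSet).subset fun i hi => ?_)
    by_cases his : i ∈ s
    · exact Or.inr his
    · exact Or.inl ⟨⟨i, his⟩, (Set.indicator_of_mem (show x ∈ C i from hi) (1 : X → ℝ≥0∞)).ge, rfl⟩

/-- An expansion of the zero function has zero sum. -/
theorem SigmaAdditiveOn.hasSum_zero {ι : Type*} [Countable ι] (hσ : SigmaAdditiveOn R μ)
    (hR : IsRingOfSets R) {C : ι → Set X} (hC : ∀ i, C i ∈ R) {γ : ι → ℝ}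
    (hγ : ∀ i, ‖γ i‖ₑ ≤ 1) (hfin : ∑' i, variation R μ (C i) ≠ ⊤)
    (hx : ∀ x, {i | x ∈ C i}.Finite → HasSum (fun i => (C i).indicator (fun _ => γ i) x) 0) :
    HasSum (fun i => γ i • μ (C i)) 0 := by
  obtain ⟨ν, hν⟩ := hσ.exists_measure hR
  let _ := MeasurableSpace.generateFrom R
  have hRm : ∀ A ∈ R, MeasurableSet A := fun A => MeasurableSpace.measurableSet_generateFrom
  have hbound : ∀ s : Finset ι,
      ‖∑ i ∈ s, γ i • μ (C i)‖ₑ ≤ ∑' i : {i // i ∉ s}, variation R μ (C i) := by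
    intro s
    obtain ⟨D, hD, hsD⟩ := hR.exists_superset hC s
    have h := hσ.enorm_add_sum_le_lintegral hR hRm (fun A hA => (hν A hA).1) hC γ s hD 0
    simp only [zero_smul, zero_add] at h
    rw [Finset.sum_congr rfl fun i hi => by rw [Set.inter_eq_left.2 (hsD i hi)]] at h
    calc _ ≤ _ := h
      _ ≤ ∫⁻ x, ‖∑ i ∈ s, (C i).indicator (fun _ => γ i) x‖ₑ ∂ν := setLIntegral_le_lintegral _ _
      _ ≤ ∫⁻ x, ∑' i : {i // i ∉ s}, (C i).indicator (1 : X → ℝ≥0∞) x ∂ν :=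
        lintegral_mono fun x => enorm_sum_indicator_le_tsum_compl hγ (hx x) s
      _ = ∑' i : {i // i ∉ s}, ν (C i) := by
        rw [lintegral_tsum fun i : {i // i ∉ s} =>
          (measurable_one.indicator (hRm _ (hC i))).aemeasurable]
        simp_rw [lintegral_indicator_one (hRm _ (hC _))]
      _ ≤ _ := ENNReal.tsum_le_tsum fun i => (hν _ (hC i)).2
  rw [HasSum, SummationFilter.unconditional_filter, tendsto_zero_iff_enorm_tendsto_zero]
  exact tendsto_of_tendsto_of_tendsto_of_le_of_le tendsto_const_nhds
    (ENNReal.tendsto_tsum_compl_atTop_zero hfin) (fun _ => zero_le) hbound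

theorem summable_smul_of_tsum_variation_ne_top [CompleteSpace E] {ι : Type*} {C : ι → Set X}
    (hC : ∀ i, C i ∈ R) {γ : ι → ℝ} (hγ : ∀ i, ‖γ i‖ₑ ≤ 1)
    (hfin : ∑' i, variation R μ (C i) ≠ ⊤) : Summable fun i => γ i • μ (C i) := by
  refine Summable.of_enorm (ne_top_of_le_ne_top hfin (ENNReal.tsum_le_tsum fun i => ?_))
  rw [enorm_smul]
  exact (mul_le_of_le_one_left' (hγ i)).trans (enorm_le_variation (hC i))

end SigmaAdditive

theorem hasSum_indicator_of_finite {X ι : Type*} {C : ι → Set X} {γ : ι → ℝ} {x : X} {a : ℝ}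
    (hx : {i | x ∈ C i}.Finite) (h : ∑ i ∈ hx.toFinset, γ i = a) :
    HasSum (fun i => (C i).indicator (fun _ => γ i) x) a := by
  have hs : ∑ i ∈ hx.toFinset, (C i).indicator (fun _ => γ i) x = a := by
    rw [← h]
    exact Finset.sum_congr rfl fun i hi => Set.indicator_of_mem (by simpa using hi) _
  rw [← hs]
  exact hasSum_sum_of_ne_finset_zero fun i hi => Set.indicator_of_notMem (by simpa using hi) _

/-- Let `μ : R → E` be a σ-additive set function of bounded variation on a
ring of subsets `R` of a nonempty set `X`, with values in a Banach space `E`.  If a set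
`S ⊆ X` admits two expansions `S ≃ ∑ₙ αₙ Aₙ` and `S ≃ ∑ₙ βₙ Bₙ` with `Aₙ, Bₙ ∈ R` and
`αₙ, βₙ ∈ {−1, 1}`, then `∑ₙ αₙ μ(Aₙ) = ∑ₙ βₙ μ(Bₙ)`, both series converging in `E`. -/
theorem stmt4 {X E : Type*} [Nonempty X]
    [NormedAddCommGroup E] [NormedSpace ℝ E] [CompleteSpace E]
    (R : Set (Set X)) (hR : IsRingOfSets R)
    (μ : Set X → E)
    (hσ : SigmaAdditiveOn R μ)
    (hbv : (⨆ A ∈ R, variation R μ A) < ⊤)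
    (S : Set X)
    (A B : ℕ → Set X) (hA : ∀ n, A n ∈ R) (hB : ∀ n, B n ∈ R)
    (α β : ℕ → ℝ) (hα : ∀ n, α n = 1 ∨ α n = -1) (hβ : ∀ n, β n = 1 ∨ β n = -1)
    (hIA : ∑' n, variation R μ (A n) < ⊤)
    (hIIA : ∀ x : X, ∀ hx : {n : ℕ | x ∈ A n}.Finite,
      ∑ n ∈ hx.toFinset, α n = S.indicator (fun _ => (1 : ℝ)) x)
    (hIB : ∑' n, variation R μ (B n) < ⊤)
    (hIIB : ∀ x : X, ∀ hx : {n : ℕ | x ∈ B n}.Finite,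
      ∑ n ∈ hx.toFinset, β n = S.indicator (fun _ => (1 : ℝ)) x) :
    ∃ v : E,
      Tendsto (fun N => ∑ n ∈ Finset.range N, α n • μ (A n)) atTop (nhds v) ∧
      Tendsto (fun N => ∑ n ∈ Finset.range N, β n • μ (B n)) atTop (nhds v) := by
  have norm_le : ∀ {c : ℝ}, c = 1 ∨ c = -1 → ‖c‖ₑ ≤ 1 := by
    rintro c (rfl | rfl) <;> simp
  have hsA := summable_smul_of_tsum_variation_ne_top hA (fun n => norm_le (hα n)) hIA.ne
  have hsB := summable_smul_of_tsum_variation_ne_top hB (fun n => norm_le (hβ n)) hIB.ne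
  have h0 : HasSum (fun i : ℕ ⊕ ℕ => Sum.elim α (-β) i • μ (Sum.elim A B i)) 0 := by
    refine hσ.hasSum_zero hR ?_ ?_ ?_ fun x hx => ?_
    · rintro (n | n)
      exacts [hA n, hB n]
    · rintro (n | n)
      · exact norm_le (hα n)
      · simpa using norm_le (hβ n)
    · rw [ENNReal.summable.tsum_sum ENNReal.summable]
      exact ENNReal.add_ne_top.2 ⟨hIA.ne, hIB.ne⟩
    · have hxA : {n | x ∈ A n}.Finite := hx.preimage Sum.inl_injective.injOn
      have hxB : {n | x ∈ B n}.Finite := hx.preimage Sum.inr_injective.injOn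
      rw [← add_neg_cancel (S.indicator (fun _ => (1 : ℝ)) x)]
      refine HasSum.sum (hasSum_indicator_of_finite hxA (hIIA x hxA)) ?_
      exact hasSum_indicator_of_finite (γ := -β) hxB (by simp [← hIIB x hxB])
  have hsum : ∑' n, α n • μ (A n) + -∑' n, β n • μ (B n) = 0 := by
    refine (HasSum.sum hsA.hasSum ?_).unique h0
    simpa [Function.comp_def] using hsB.hasSum.neg
  refine ⟨_, hsA.hasSum.tendsto_sum_nat, ?_⟩
  rw [add_neg_eq_zero.1 hsum]
  exact hsB.hasSum.tendsto_sum_nat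
end

section
/- Let (X, Σ) be a measurable space, E a Banach space, ν a finite positive measure on (X, Σ), and f : X → E a Bochner integrable function with respect to ν. Define ω(S) = ∫_S f dν for S ∈ Σ. Then there exist vectors v₁, v₂, … ∈ E and finite positive measures μ₁, μ₂, … on (X, Σ) with Σ_{n=1}^∞ ‖vₙ‖ μₙ(X) < ∞ such that ω(S) = Σ_{n=1}^∞ μₙ(S) vₙ for every S ∈ Σ. -/
open MeasureTheory Filter
open scoped ENNReal NNReal

/-- A Bochner integrable function is the limit in `L¹` of a sequence of integrable simple functions
which starts at `0` and whose `L¹` distances to the function are summable. -/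
theorem exists_simpleFunc_seq_tsum_lintegral_sub_ne_top {X E : Type*} [MeasurableSpace X]
    [NormedAddCommGroup E] {ν : Measure X} {f : X → E} (hf : Integrable f ν) :
    ∃ g : ℕ → SimpleFunc X E, g 0 = 0 ∧ (∀ k, Integrable (g k) ν) ∧
      ∑' k, ∫⁻ x, ‖g k x - f x‖ₑ ∂ν ≠ ⊤ := by
  obtain ⟨ε, hε, hεsum⟩ := ENNReal.exists_pos_sum_of_countable' one_ne_zero ℕ
  have happrox : ∀ k, ∃ g : SimpleFunc X E,
      eLpNorm (f - ⇑g) 1 ν < ε k ∧ MemLp g 1 ν := fun k =>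
    (memLp_one_iff_integrable.2 hf).exists_simpleFunc_eLpNorm_sub_lt (by simp) (hε k).ne'
  choose g hg hgint using happrox
  refine ⟨fun n => Nat.casesOn n 0 g, rfl, ?_, ?_⟩
  · rintro (_ | k)
    · exact integrable_zero _ _ _
    · exact memLp_one_iff_integrable.1 (hgint k)
  · rw [tsum_eq_zero_add' ENNReal.summable]
    refine ENNReal.add_ne_top.2 ⟨?_, ?_⟩
    · simpa using! hf.2.ne
    · refine ne_top_of_le_ne_top (hεsum.trans ENNReal.one_lt_top).ne
        (ENNReal.tsum_le_tsum fun k => ?_)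
      have h := (hg k).le
      rw [eLpNorm_one_eq_lintegral_enorm] at h
      simpa only [Pi.sub_apply, enorm_sub_rev] using h

/-- Reindexing along `ℕ` a countable family of vectors and finite measures. -/
theorem exists_nat_seq_of_countable {X E ι : Type*} [MeasurableSpace X] [Countable ι]
    [NormedAddCommGroup E] [NormedSpace ℝ E] (v : ι → E) (μ : ι → Measure X)
    (hμ : ∀ i, IsFiniteMeasure (μ i)) :
    ∃ (w : ℕ → E) (ρ : ℕ → Measure X), (∀ n, IsFiniteMeasure (ρ n)) ∧
      ∑' n, ‖w n‖ₑ * ρ n Set.univ = ∑' i, ‖v i‖ₑ * μ i Set.univ ∧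
      ∀ S, ∑' n, (ρ n S).toReal • w n = ∑' i, (μ i S).toReal • v i := by
  obtain ⟨e, he⟩ := exists_injective_nat ι
  have hv : ∀ i, Function.extend e v 0 (e i) = v i := he.extend_apply v 0
  have hμe : ∀ i, Function.extend e μ 0 (e i) = μ i := he.extend_apply μ 0
  have hv0 : ∀ n, n ∉ Set.range e → Function.extend e v 0 n = 0 := fun n hn =>
    Function.extend_apply' _ _ _ hn
  refine ⟨Function.extend e v 0, Function.extend e μ 0, fun n => ?_, ?_, fun S => ?_⟩
  · by_cases hn : ∃ i, e i = n
    · obtain ⟨i, rfl⟩ := hn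
      rw [hμe]
      exact hμ i
    · rw [Function.extend_apply' _ _ _ hn]
      exact inferInstanceAs (IsFiniteMeasure (0 : Measure X))
  · rw [← he.tsum_eq]
    · simp only [hv, hμe]
    · intro n hn
      by_contra h
      exact hn (by simp [hv0 n h])
  · rw [← he.tsum_eq]
    · simp only [hv, hμe]
    · intro n hn
      by_contra h
      exact hn (by simp [hv0 n h])

/-- Let `(X, Σ)` be a measurable space, `E` a Banach space, `ν` a finite
positive measure on `(X, Σ)`, and `f : X → E` Bochner integrable with respect to `ν`.
Define `ω(S) = ∫_S f dν`.  Then there are vectors `v₁, v₂, … ∈ E` and finite positive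
measures `μ₁, μ₂, …` on `(X, Σ)` with `∑ₙ ‖vₙ‖ μₙ(X) < ∞` such that
`ω(S) = ∑ₙ μₙ(S) vₙ` for every `S ∈ Σ`. -/
theorem stmt7 {X E : Type*} [MeasurableSpace X]
    [NormedAddCommGroup E] [NormedSpace ℝ E] [CompleteSpace E]
    (ν : Measure X) (hν : IsFiniteMeasure ν)
    (f : X → E) (hf : Integrable f ν)
    (ω : Set X → E) (hω : ∀ S : Set X, ω S = ∫ x in S, f x ∂ν) :
    ∃ (v : ℕ → E) (μs : ℕ → Measure X),
      (∀ n, IsFiniteMeasure (μs n)) ∧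
      ∑' n, (‖v n‖₊ : ℝ≥0∞) * μs n Set.univ < ⊤ ∧
      ∀ S : Set X, MeasurableSet S → ω S = ∑' n, (μs n S).toReal • v n := by
  obtain ⟨g, hg0, hgint, hgsum⟩ := exists_simpleFunc_seq_tsum_lintegral_sub_ne_top hf
  let h : ℕ → SimpleFunc X E := fun k => g (k + 1) - g k
  have hhint : ∀ k, Integrable (h k) ν := fun k => (hgint (k + 1)).sub (hgint k)
  have hhsum : ∑' k, ∫⁻ x, ‖h k x‖ₑ ∂ν ≠ ⊤ := by
    have hle : ∀ k, ∫⁻ x, ‖h k x‖ₑ ∂ν ≤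
        ∫⁻ x, ‖g (k + 1) x - f x‖ₑ ∂ν + ∫⁻ x, ‖g k x - f x‖ₑ ∂ν := fun k => by
      have hmeas : AEMeasurable (fun x => ‖g (k + 1) x - f x‖ₑ) ν :=
        ((hgint (k + 1)).sub hf).aestronglyMeasurable.enorm
      rw [← lintegral_add_left' hmeas]
      refine lintegral_mono fun x => ?_
      have : h k x = (g (k + 1) x - f x) - (g k x - f x) := by simp [h]
      rw [this]
      exact enorm_sub_le
    refine ne_top_of_le_ne_top ?_ (ENNReal.tsum_le_tsum hle)
    rw [ENNReal.tsum_add]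
    refine ENNReal.add_ne_top.2 ⟨ne_top_of_le_ne_top hgsum ?_, hgsum⟩
    exact ENNReal.tsum_comp_le_tsum_of_injective (add_left_injective 1) _
  let v : (Σ k, (h k).range) → E := fun i => i.2
  let μ : (Σ k, (h k).range) → Measure X := fun i => ν.restrict (h i.1 ⁻¹' {(i.2 : E)})
  have hμsum : ∑' i, ‖v i‖ₑ * μ i Set.univ ≠ ⊤ := by
    rw [ENNReal.tsum_sigma']
    convert hhsum using 3 with k
    have hk := SimpleFunc.map_lintegral (μ := ν) (fun y : E => ‖y‖ₑ) (h k)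
    rw [← SimpleFunc.lintegral_eq_lintegral] at hk
    simp only [SimpleFunc.coe_map, Function.comp_apply] at hk
    rw [hk, tsum_fintype, ← Finset.sum_coe_sort (h k).range]
    simp [v, μ]
  obtain ⟨w, ρ, hρ, hρsum, hρS⟩ := exists_nat_seq_of_countable v μ fun i => inferInstance
  refine ⟨w, ρ, hρ, ?_, fun S hS => ?_⟩
  · exact (hρsum.trans_ne hμsum).lt_top
  have hsummable : Summable fun i => (μ i S).toReal • v i := by
    refine Summable.of_norm_bounded (ENNReal.summable_toReal hμsum) fun i => ?_
    rw [norm_smul, ENNReal.toReal_mul, toReal_enorm, mul_comm,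
      Real.norm_of_nonneg ENNReal.toReal_nonneg]
    gcongr
    · exact measure_ne_top _ _
    · exact Set.subset_univ S
  have hinner : ∀ k, ∑' y : (h k).range, (μ ⟨k, y⟩ S).toReal • v ⟨k, y⟩ =
      ∫ x in S, h k x ∂ν := fun k => by
    rw [SimpleFunc.integral_eq_sum _ (hhint k).integrableOn, tsum_fintype,
      ← Finset.sum_coe_sort (h k).range]
    refine Finset.sum_congr rfl fun y _ => ?_
    simp only [v, μ, Measure.real]
    rw [Measure.restrict_apply hS, Measure.restrict_apply ((h k).measurableSet_preimage _),
      Set.inter_comm]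
  have hpartial : ∀ n, ∑ k ∈ Finset.range n, ∫ x in S, h k x ∂ν = ∫ x in S, g n x ∂ν :=
    fun n => by
    have hk : ∀ k, ∫ x in S, h k x ∂ν = ∫ x in S, g (k + 1) x ∂ν - ∫ x in S, g k x ∂ν :=
      fun k => integral_sub (hgint (k + 1)).integrableOn (hgint k).integrableOn
    simp only [hk]
    rw [Finset.sum_range_sub (fun k => ∫ x in S, g k x ∂ν), hg0]
    simp
  have hlim : Tendsto (fun n => ∫ x in S, g n x ∂ν) atTop (nhds (∫ x in S, f x ∂ν)) :=
    tendsto_setIntegral_of_L1 f hf.aestronglyMeasurable (Eventually.of_forall hgint)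
      (ENNReal.tendsto_atTop_zero_of_tsum_ne_top hgsum) S
  rw [hω, hρS, hsummable.tsum_sigma]
  have hsum := hsummable.sigma
  simp only [hinner] at hsum ⊢
  refine tendsto_nhds_unique hlim ?_
  simpa only [hpartial] using hsum.hasSum.tendsto_sum_nat
end

section
/- Let (X, Σ_X) and (Y, Σ_Y) be measurable spaces and let Φ be a strongly additive transfunction, i.e. Φ maps finite positive measures on (X, Σ_X) to finite positive measures on (Y, Σ_Y) and Φ(μ₁ + μ₂) = Φ(μ₁) + Φ(μ₂) for all finite positive measures μ₁, μ₂. Define Φ̃ on finite signed measures by Φ̃σ = Φ(σ⁺) − Φ(σ⁻), where σ = σ⁺ − σ⁻ is the Jordan decomposition. Then for all finite positive measures μ₁, μ₂ on (X, Σ_X), Φ̃(μ₁ − μ₂) = Φ(μ₁) − Φ(μ₂), where μ₁ − μ₂ denotes the finite signed measure A ↦ μ₁(A) − μ₂(A). -/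
open MeasureTheory Filter
open scoped ENNReal NNReal

/-- The extension `Φ̃` of a transfunction `Φ` (a map from finite positive measures on `X`
to finite positive measures on `Y`) to finite signed measures, via the Jordan
decomposition: `Φ̃σ = Φ(σ⁺) − Φ(σ⁻)`. -/
noncomputable def tilde {X Y : Type*} [MeasurableSpace X] [MeasurableSpace Y]
    (Φ : Measure X → Measure Y)
    (hΦ : ∀ μ : Measure X, IsFiniteMeasure μ → IsFiniteMeasure (Φ μ))
    (σ : SignedMeasure X) : SignedMeasure Y :=
  (@Measure.toSignedMeasure Y _ (Φ σ.toJordanDecomposition.posPart)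
      (hΦ _ inferInstance)) -
  (@Measure.toSignedMeasure Y _ (Φ σ.toJordanDecomposition.negPart)
      (hΦ _ inferInstance))

/-- Finite measures with `μ₁ - μ₂ = ν₁ - ν₂` as signed measures satisfy `μ₁ + ν₂ = ν₁ + μ₂`. -/
theorem MeasureTheory.Measure.add_eq_add_of_toSignedMeasure_sub_eq {X : Type*}
    [MeasurableSpace X] {μ₁ μ₂ ν₁ ν₂ : Measure X} [IsFiniteMeasure μ₁] [IsFiniteMeasure μ₂]
    [IsFiniteMeasure ν₁] [IsFiniteMeasure ν₂]
    (h : μ₁.toSignedMeasure - μ₂.toSignedMeasure = ν₁.toSignedMeasure - ν₂.toSignedMeasure) :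
    μ₁ + ν₂ = ν₁ + μ₂ := by
  rw [← Measure.toSignedMeasure_eq_toSignedMeasure_iff, Measure.toSignedMeasure_add,
    Measure.toSignedMeasure_add]
  exact sub_eq_sub_iff_add_eq_add.mp h

/-- If `Φ` is a strongly additive transfunction and `Φ̃` is its extension
to finite signed measures via the Jordan decomposition, then for all finite positive
measures `μ₁, μ₂`, `Φ̃(μ₁ − μ₂) = Φ(μ₁) − Φ(μ₂)`. -/
theorem stmt8 {X Y : Type*} [MeasurableSpace X] [MeasurableSpace Y]
    (Φ : Measure X → Measure Y)
    (hΦ : ∀ μ : Measure X, IsFiniteMeasure μ → IsFiniteMeasure (Φ μ))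
    (hadd : ∀ μ₁ μ₂ : Measure X, IsFiniteMeasure μ₁ → IsFiniteMeasure μ₂ →
      Φ (μ₁ + μ₂) = Φ μ₁ + Φ μ₂)
    (μ₁ μ₂ : Measure X) (h₁ : IsFiniteMeasure μ₁) (h₂ : IsFiniteMeasure μ₂) :
    tilde Φ hΦ ((@Measure.toSignedMeasure X _ μ₁ h₁) - (@Measure.toSignedMeasure X _ μ₂ h₂)) =
      (@Measure.toSignedMeasure Y _ (Φ μ₁) (hΦ μ₁ h₁)) -
      (@Measure.toSignedMeasure Y _ (Φ μ₂) (hΦ μ₂ h₂)) := by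
  set σ := μ₁.toSignedMeasure - μ₂.toSignedMeasure with hσ
  have hparts : σ.toJordanDecomposition.posPart + μ₂ = μ₁ + σ.toJordanDecomposition.negPart :=
    Measure.add_eq_add_of_toSignedMeasure_sub_eq
      (σ.toSignedMeasure_toJordanDecomposition.trans hσ)
  have hΦparts := congrArg Φ hparts
  rw [hadd _ _ inferInstance h₂, hadd _ _ h₁ inferInstance] at hΦparts
  have := hΦ _ h₁
  have := hΦ _ h₂
  have := hΦ σ.toJordanDecomposition.posPart inferInstance
  have := hΦ σ.toJordanDecomposition.negPart inferInstance
  rw [tilde, sub_eq_sub_iff_add_eq_add, ← Measure.toSignedMeasure_add,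
    ← Measure.toSignedMeasure_add]
  exact Measure.toSignedMeasure_congr hΦparts
end

section
/- Let (X, Σ_X) and (Y, Σ_Y) be measurable spaces and let Φ be a weakly additive transfunction, i.e. Φ maps finite positive measures on (X, Σ_X) to finite positive measures on (Y, Σ_Y) and Φ(μ₁ + μ₂) = Φ(μ₁) + Φ(μ₂) whenever the finite positive measures μ₁, μ₂ are mutually singular. Let Φ̃σ = Φ(σ⁺) − Φ(σ⁻) be its extension to finite signed measures via the Jordan decomposition. Then for all finite signed measures μ₁, μ₂ on (X, Σ_X) with μ₁ ⟂ μ₂, one has Φ̃(μ₁ + μ₂) = Φ̃(μ₁) + Φ̃(μ₂) and Φ̃(μ₁ − μ₂) = Φ̃(μ₁) − Φ̃(μ₂). -/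
open MeasureTheory Filter
open scoped ENNReal NNReal

/-- The positive and negative parts of the sum of two mutually singular signed measures are the
sums of their positive and negative parts. -/
theorem toJordanDecomposition_add_of_mutuallySingular {X : Type*} [MeasurableSpace X]
    {σ τ : SignedMeasure X} (h : σ.totalVariation ⟂ₘ τ.totalVariation) :
    (σ + τ).toJordanDecomposition.posPart =
        σ.toJordanDecomposition.posPart + τ.toJordanDecomposition.posPart ∧
      (σ + τ).toJordanDecomposition.negPart =
        σ.toJordanDecomposition.negPart + τ.toJordanDecomposition.negPart := by
  simp only [SignedMeasure.totalVariation, Measure.MutuallySingular.add_left_iff,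
    Measure.MutuallySingular.add_right_iff] at h
  obtain ⟨⟨-, hnp⟩, hpn, -⟩ := h
  let j : JordanDecomposition X :=
    { posPart := σ.toJordanDecomposition.posPart + τ.toJordanDecomposition.posPart
      negPart := σ.toJordanDecomposition.negPart + τ.toJordanDecomposition.negPart
      posPart_finite := inferInstance
      negPart_finite := inferInstance
      mutuallySingular :=
        (σ.toJordanDecomposition.mutuallySingular.add_right hpn).add_left
          (hnp.symm.add_right τ.toJordanDecomposition.mutuallySingular) }
  have hj : (σ + τ).toJordanDecomposition = j := by
    apply SignedMeasure.toJordanDecomposition_eq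
    rw [← σ.toSignedMeasure_toJordanDecomposition, ← τ.toSignedMeasure_toJordanDecomposition]
    simp only [JordanDecomposition.toSignedMeasure, j, Measure.toSignedMeasure_add]
    abel
  rw [hj]
  exact ⟨rfl, rfl⟩

theorem tilde_neg {X Y : Type*} [MeasurableSpace X] [MeasurableSpace Y]
    (Φ : Measure X → Measure Y)
    (hΦ : ∀ μ : Measure X, IsFiniteMeasure μ → IsFiniteMeasure (Φ μ))
    (σ : SignedMeasure X) : tilde Φ hΦ (-σ) = -tilde Φ hΦ σ := by
  simp [tilde, SignedMeasure.toJordanDecomposition_neg]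

theorem tilde_add_of_mutuallySingular {X Y : Type*} [MeasurableSpace X] [MeasurableSpace Y]
    (Φ : Measure X → Measure Y)
    (hΦ : ∀ μ : Measure X, IsFiniteMeasure μ → IsFiniteMeasure (Φ μ))
    (hadd : ∀ μ₁ μ₂ : Measure X, IsFiniteMeasure μ₁ → IsFiniteMeasure μ₂ →
      μ₁ ⟂ₘ μ₂ → Φ (μ₁ + μ₂) = Φ μ₁ + Φ μ₂)
    {σ τ : SignedMeasure X} (hsing : σ ⟂ᵥ τ) :
    tilde Φ hΦ (σ + τ) = tilde Φ hΦ σ + tilde Φ hΦ τ := by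
  have h := (SignedMeasure.mutuallySingular_iff σ τ).1 hsing
  obtain ⟨hpos, hneg⟩ := toJordanDecomposition_add_of_mutuallySingular h
  simp only [SignedMeasure.totalVariation, Measure.MutuallySingular.add_left_iff,
    Measure.MutuallySingular.add_right_iff] at h
  obtain ⟨⟨hpp, -⟩, -, hnn⟩ := h
  have (μ : Measure X) [hμ : IsFiniteMeasure μ] : IsFiniteMeasure (Φ μ) := hΦ μ hμ
  simp only [tilde, hpos, hneg, hadd _ _ inferInstance inferInstance hpp,
    hadd _ _ inferInstance inferInstance hnn, Measure.toSignedMeasure_add]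
  abel

/-- If `Φ` is a weakly additive transfunction (additive on mutually
singular pairs of finite positive measures) and `Φ̃` is its extension to finite signed
measures via the Jordan decomposition, then for all finite signed measures `μ₁ ⟂ μ₂`,
`Φ̃(μ₁ + μ₂) = Φ̃μ₁ + Φ̃μ₂` and `Φ̃(μ₁ − μ₂) = Φ̃μ₁ − Φ̃μ₂`. -/
theorem stmt9 {X Y : Type*} [MeasurableSpace X] [MeasurableSpace Y]
    (Φ : Measure X → Measure Y)
    (hΦ : ∀ μ : Measure X, IsFiniteMeasure μ → IsFiniteMeasure (Φ μ))
    (hadd : ∀ μ₁ μ₂ : Measure X, IsFiniteMeasure μ₁ → IsFiniteMeasure μ₂ →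
      μ₁ ⟂ₘ μ₂ → Φ (μ₁ + μ₂) = Φ μ₁ + Φ μ₂)
    (μ₁ μ₂ : SignedMeasure X) (hsing : μ₁ ⟂ᵥ μ₂) :
    tilde Φ hΦ (μ₁ + μ₂) = tilde Φ hΦ μ₁ + tilde Φ hΦ μ₂ ∧
    tilde Φ hΦ (μ₁ - μ₂) = tilde Φ hΦ μ₁ - tilde Φ hΦ μ₂ := by
  refine ⟨tilde_add_of_mutuallySingular Φ hΦ hadd hsing, ?_⟩
  rw [sub_eq_add_neg, tilde_add_of_mutuallySingular Φ hΦ hadd hsing.neg_right, tilde_neg,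
    sub_eq_add_neg]
end

section
/- Let (X, Σ_X) and (Y, Σ_Y) be measurable spaces and let Φ be a strongly additive transfunction, i.e. Φ maps finite positive measures on (X, Σ_X) to finite positive measures on (Y, Σ_Y) and Φ(μ₁ + μ₂) = Φ(μ₁) + Φ(μ₂) for all finite positive measures μ₁, μ₂. Let Φ̃σ = Φ(σ⁺) − Φ(σ⁻) be its extension to finite signed measures via the Jordan decomposition. Then Φ̃ is strongly additive: Φ̃(σ₁ + σ₂) = Φ̃(σ₁) + Φ̃(σ₂) for all finite signed measures σ₁, σ₂ on (X, Σ_X). -/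
open MeasureTheory Filter
open scoped ENNReal NNReal

/-- For a strongly additive `Φ`, the extension of `Φ` can be computed from any decomposition of a
signed measure as a difference of finite measures. -/
theorem tilde_eq_of_eq_sub {X Y : Type*} [MeasurableSpace X] [MeasurableSpace Y]
    (Φ : Measure X → Measure Y)
    (hΦ : ∀ μ : Measure X, IsFiniteMeasure μ → IsFiniteMeasure (Φ μ))
    (hadd : ∀ μ₁ μ₂ : Measure X, IsFiniteMeasure μ₁ → IsFiniteMeasure μ₂ →
      Φ (μ₁ + μ₂) = Φ μ₁ + Φ μ₂)
    {σ : SignedMeasure X} {μ ν : Measure X} [hμ : IsFiniteMeasure μ] [hν : IsFiniteMeasure ν]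
    (h : σ = μ.toSignedMeasure - ν.toSignedMeasure) :
    tilde Φ hΦ σ =
      @Measure.toSignedMeasure Y _ (Φ μ) (hΦ μ hμ) -
        @Measure.toSignedMeasure Y _ (Φ ν) (hΦ ν hν) := by
  have hσ := σ.toSignedMeasure_toJordanDecomposition
  unfold tilde
  set p := σ.toJordanDecomposition.posPart
  set n := σ.toJordanDecomposition.negPart
  have : IsFiniteMeasure p := σ.toJordanDecomposition.posPart_finite
  have : IsFiniteMeasure n := σ.toJordanDecomposition.negPart_finite
  have hpn : p.toSignedMeasure - n.toSignedMeasure = μ.toSignedMeasure - ν.toSignedMeasure :=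
    hσ.trans h
  have hsum : p + ν = μ + n := by
    rw [← Measure.toSignedMeasure_eq_toSignedMeasure_iff, Measure.toSignedMeasure_add,
      Measure.toSignedMeasure_add]
    exact sub_eq_sub_iff_add_eq_add.mp hpn
  have : IsFiniteMeasure (Φ p) := hΦ p inferInstance
  have : IsFiniteMeasure (Φ n) := hΦ n inferInstance
  have : IsFiniteMeasure (Φ μ) := hΦ μ hμ
  have : IsFiniteMeasure (Φ ν) := hΦ ν hν
  have hΦsum : Φ p + Φ ν = Φ μ + Φ n := by
    rw [← hadd p ν inferInstance hν, hsum, hadd μ n hμ inferInstance]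
  rw [sub_eq_sub_iff_add_eq_add, ← Measure.toSignedMeasure_add, ← Measure.toSignedMeasure_add]
  exact Measure.toSignedMeasure_congr hΦsum

/-- If `Φ` is a strongly additive transfunction, then its extension `Φ̃`
to finite signed measures via the Jordan decomposition is strongly additive:
`Φ̃(σ₁ + σ₂) = Φ̃σ₁ + Φ̃σ₂` for all finite signed measures `σ₁, σ₂`. -/
theorem stmt10 {X Y : Type*} [MeasurableSpace X] [MeasurableSpace Y]
    (Φ : Measure X → Measure Y)
    (hΦ : ∀ μ : Measure X, IsFiniteMeasure μ → IsFiniteMeasure (Φ μ))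
    (hadd : ∀ μ₁ μ₂ : Measure X, IsFiniteMeasure μ₁ → IsFiniteMeasure μ₂ →
      Φ (μ₁ + μ₂) = Φ μ₁ + Φ μ₂)
    (σ₁ σ₂ : SignedMeasure X) :
    tilde Φ hΦ (σ₁ + σ₂) = tilde Φ hΦ σ₁ + tilde Φ hΦ σ₂ := by
  have h : σ₁ + σ₂ =
      (σ₁.toJordanDecomposition.posPart + σ₂.toJordanDecomposition.posPart).toSignedMeasure -
        (σ₁.toJordanDecomposition.negPart + σ₂.toJordanDecomposition.negPart).toSignedMeasure := by
    rw [Measure.toSignedMeasure_add, Measure.toSignedMeasure_add, add_sub_add_comm]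
    exact congrArg₂ (· + ·) σ₁.toSignedMeasure_toJordanDecomposition.symm
      σ₂.toSignedMeasure_toJordanDecomposition.symm
  have := hΦ σ₁.toJordanDecomposition.posPart inferInstance
  have := hΦ σ₁.toJordanDecomposition.negPart inferInstance
  have := hΦ σ₂.toJordanDecomposition.posPart inferInstance
  have := hΦ σ₂.toJordanDecomposition.negPart inferInstance
  have := hΦ (σ₁.toJordanDecomposition.posPart + σ₂.toJordanDecomposition.posPart) inferInstance
  have := hΦ (σ₁.toJordanDecomposition.negPart + σ₂.toJordanDecomposition.negPart) inferInstance
  rw [tilde_eq_of_eq_sub Φ hΦ hadd h]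
  unfold tilde
  rw [← add_sub_add_comm, ← Measure.toSignedMeasure_add, ← Measure.toSignedMeasure_add]
  exact congrArg₂ (· - ·)
    (Measure.toSignedMeasure_congr (hadd _ _ inferInstance inferInstance))
    (Measure.toSignedMeasure_congr (hadd _ _ inferInstance inferInstance))
end

section
/- Let (X, Σ_X) and (Y, Σ_Y) be measurable spaces and let Φ be a transfunction (a map from finite positive measures on (X, Σ_X) to finite positive measures on (Y, Σ_Y)) that is monotone (μ₁(A) ≤ μ₂(A) for all A ∈ Σ_X implies Φ(μ₁)(B) ≤ Φ(μ₂)(B) for all B ∈ Σ_Y) and strongly additive (Φ(μ₁ + μ₂) = Φ(μ₁) + Φ(μ₂) for all finite positive measures μ₁, μ₂). Let Φ̃σ = Φ(σ⁺) − Φ(σ⁻) be its extension to finite signed measures via the Jordan decomposition. Then Φ̃ is monotone: if σ₁, σ₂ are finite signed measures with σ₁(A) ≤ σ₂(A) for all A ∈ Σ_X, then Φ̃σ₁(B) ≤ Φ̃σ₂(B) for all B ∈ Σ_Y. -/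
open MeasureTheory Filter
open scoped ENNReal NNReal

/-- If `Φ` is a monotone, strongly additive transfunction, then its
extension `Φ̃` to finite signed measures via the Jordan decomposition is monotone: if
`σ₁(A) ≤ σ₂(A)` for all `A ∈ Σ_X`, then `Φ̃σ₁(B) ≤ Φ̃σ₂(B)` for all `B ∈ Σ_Y`. -/
theorem stmt12 {X Y : Type*} [MeasurableSpace X] [MeasurableSpace Y]
    (Φ : Measure X → Measure Y)
    (hΦ : ∀ μ : Measure X, IsFiniteMeasure μ → IsFiniteMeasure (Φ μ))
    (hmono : ∀ μ₁ μ₂ : Measure X, IsFiniteMeasure μ₁ → IsFiniteMeasure μ₂ →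
      (∀ A : Set X, MeasurableSet A → μ₁ A ≤ μ₂ A) →
      (∀ B : Set Y, MeasurableSet B → Φ μ₁ B ≤ Φ μ₂ B))
    (hadd : ∀ μ₁ μ₂ : Measure X, IsFiniteMeasure μ₁ → IsFiniteMeasure μ₂ →
      Φ (μ₁ + μ₂) = Φ μ₁ + Φ μ₂)
    (σ₁ σ₂ : SignedMeasure X)
    (hle : ∀ A : Set X, MeasurableSet A → σ₁ A ≤ σ₂ A) :
    ∀ B : Set Y, MeasurableSet B → tilde Φ hΦ σ₁ B ≤ tilde Φ hΦ σ₂ B := by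
  intro B hB
  set p₁ := σ₁.toJordanDecomposition.posPart with hp₁
  set n₁ := σ₁.toJordanDecomposition.negPart with hn₁
  set p₂ := σ₂.toJordanDecomposition.posPart with hp₂
  set n₂ := σ₂.toJordanDecomposition.negPart with hn₂
  have : IsFiniteMeasure (Φ p₁) := hΦ _ inferInstance
  have : IsFiniteMeasure (Φ n₁) := hΦ _ inferInstance
  have : IsFiniteMeasure (Φ p₂) := hΦ _ inferInstance
  have : IsFiniteMeasure (Φ n₂) := hΦ _ inferInstance
  have hcross : ∀ A : Set X, MeasurableSet A → (p₁ + n₂) A ≤ (p₂ + n₁) A := by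
    intro A hA
    have h := hle A hA
    rw [σ₁.apply_eq_posPart_real_sub_negPart_real hA,
      σ₂.apply_eq_posPart_real_sub_negPart_real hA, ← hp₁, ← hn₁, ← hp₂, ← hn₂] at h
    rw [← ENNReal.toReal_le_toReal (measure_ne_top _ _) (measure_ne_top _ _),
      ← measureReal_def, ← measureReal_def, measureReal_add_apply, measureReal_add_apply]
    linarith
  have hΦle := hmono _ _ inferInstance inferInstance hcross B hB
  rw [hadd _ _ inferInstance inferInstance, hadd _ _ inferInstance inferInstance,
    ← ENNReal.toReal_le_toReal (measure_ne_top _ _) (measure_ne_top _ _),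
      ← measureReal_def, ← measureReal_def, measureReal_add_apply, measureReal_add_apply] at hΦle
  have h₁ : tilde Φ hΦ σ₁ B = (Φ p₁).real B - (Φ n₁).real B :=
    Measure.toSignedMeasure_sub_apply hB
  have h₂ : tilde Φ hΦ σ₂ B = (Φ p₂).real B - (Φ n₂).real B :=
    Measure.toSignedMeasure_sub_apply hB
  rw [h₁, h₂]
  linarith
end

section
/- Let (X, Σ_X) and (Y, Σ_Y) be measurable spaces and let Φ be a transfunction (a map from finite positive measures on (X, Σ_X) to finite positive measures on (Y, Σ_Y)) that is continuous with respect to uniform convergence: whenever μₙ, μ are finite positive measures with ‖μₙ − μ‖ → 0 (total variation norm of the signed measure μₙ − μ), one has ‖Φ(μₙ) − Φ(μ)‖ → 0. Let Φ̃σ = Φ(σ⁺) − Φ(σ⁻) be its extension to finite signed measures via the Jordan decomposition. Then Φ̃ is continuous with respect to uniform convergence: if σₙ, σ are finite signed measures with ‖σₙ − σ‖ → 0, then ‖Φ̃(σₙ) − Φ̃(σ)‖ → 0. -/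
open MeasureTheory Filter
open scoped ENNReal NNReal

namespace MeasureTheory.SignedMeasure

variable {X : Type*} [MeasurableSpace X]

lemma posPart_real_le_add_totalVariation_sub (s t : SignedMeasure X) {E : Set X}
    (hE : MeasurableSet E) :
    s.toJordanDecomposition.posPart.real E ≤
      t.toJordanDecomposition.posPart.real E + (s - t).totalVariation.real E := by
  obtain ⟨i, hi, hpos, -, hposPart, -⟩ := s.toJordanDecomposition_spec
  have h₁ : s.toJordanDecomposition.posPart.real E = s (i ∩ E) := by
    rw [hposPart, s.toMeasureOfZeroLE_real_apply hpos hi hE]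
  have h₂ : t (i ∩ E) ≤ t.toJordanDecomposition.posPart.real E := by
    rw [t.apply_eq_posPart_real_sub_negPart_real (hi.inter hE)]
    have : t.toJordanDecomposition.posPart.real (i ∩ E) ≤
        t.toJordanDecomposition.posPart.real E := measureReal_mono Set.inter_subset_right
    have : 0 ≤ t.toJordanDecomposition.negPart.real (i ∩ E) := measureReal_nonneg
    linarith
  have h₃ : (s - t) (i ∩ E) ≤ (s - t).totalVariation.real E :=
    (le_abs_self _).trans <| ((s - t).norm_le_totalVariation _).trans <|
      measureReal_mono Set.inter_subset_right
  rw [sub_apply] at h₃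
  linarith

lemma totalVariation_sub_comm (s t : SignedMeasure X) :
    (s - t).totalVariation = (t - s).totalVariation := by
  rw [← neg_sub, totalVariation_neg]

lemma totalVariation_sub_le (s t : SignedMeasure X) :
    (s - t).totalVariation ≤ s.totalVariation + t.totalVariation := by
  simpa only [totalVariation_eq_variation] using VectorMeasure.variation_sub_le

lemma abs_posPart_real_sub_le (s t : SignedMeasure X) {E : Set X} (hE : MeasurableSet E) :
    |s.toJordanDecomposition.posPart.real E - t.toJordanDecomposition.posPart.real E| ≤
      (s - t).totalVariation.real E := by
  have h₁ := posPart_real_le_add_totalVariation_sub s t hE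
  have h₂ := posPart_real_le_add_totalVariation_sub t s hE
  rw [totalVariation_sub_comm] at h₂
  exact abs_sub_le_iff.2 ⟨by linarith, by linarith⟩

lemma abs_negPart_real_sub_le (s t : SignedMeasure X) {E : Set X} (hE : MeasurableSet E) :
    |s.toJordanDecomposition.negPart.real E - t.toJordanDecomposition.negPart.real E| ≤
      (s - t).totalVariation.real E := by
  have h := abs_posPart_real_sub_le (-s) (-t) hE
  rwa [toJordanDecomposition_neg, toJordanDecomposition_neg, JordanDecomposition.neg_posPart,
    JordanDecomposition.neg_posPart, neg_sub_neg, totalVariation_sub_comm] at h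

lemma totalVariation_toSignedMeasure_sub_le {μ ν ρ : Measure X} [IsFiniteMeasure μ]
    [IsFiniteMeasure ν]
    (h : ∀ E, MeasurableSet E → |μ.real E - ν.real E| ≤ ρ.real E) :
    (μ.toSignedMeasure - ν.toSignedMeasure).totalVariation ≤ ρ := by
  rw [totalVariation_eq_variation]
  refine VectorMeasure.variation_le_of_forall_enorm_le fun E hE ↦ ?_
  rw [Measure.toSignedMeasure_sub_apply hE, ← ofReal_norm, Real.norm_eq_abs]
  exact ENNReal.ofReal_le_of_le_toReal (h E hE)

end MeasureTheory.SignedMeasure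

/-- If `Φ` is a transfunction continuous with respect to uniform
convergence (convergence in total variation norm), then so is its extension `Φ̃` to
finite signed measures via the Jordan decomposition. -/
theorem stmt14 {X Y : Type*} [MeasurableSpace X] [MeasurableSpace Y]
    (Φ : Measure X → Measure Y)
    (hΦ : ∀ μ : Measure X, IsFiniteMeasure μ → IsFiniteMeasure (Φ μ))
    (hcont : ∀ (μs : ℕ → Measure X) (μ : Measure X)
      (h1 : ∀ n, IsFiniteMeasure (μs n)) (h2 : IsFiniteMeasure μ),
      Tendsto (fun n =>
          ((@Measure.toSignedMeasure X _ (μs n) (h1 n)) -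
            (@Measure.toSignedMeasure X _ μ h2)).totalVariation Set.univ)
        atTop (nhds 0) →
      Tendsto (fun n =>
          ((@Measure.toSignedMeasure Y _ (Φ (μs n)) (hΦ _ (h1 n))) -
            (@Measure.toSignedMeasure Y _ (Φ μ) (hΦ _ h2))).totalVariation Set.univ)
        atTop (nhds 0))
    (σs : ℕ → SignedMeasure X) (σ : SignedMeasure X)
    (h : Tendsto (fun n => (σs n - σ).totalVariation Set.univ) atTop (nhds 0)) :
    Tendsto (fun n => (tilde Φ hΦ (σs n) - tilde Φ hΦ σ).totalVariation Set.univ)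
      atTop (nhds 0) := by
  have hpos := hcont (fun n ↦ (σs n).toJordanDecomposition.posPart)
    σ.toJordanDecomposition.posPart (fun _ ↦ inferInstance) inferInstance <|
    tendsto_of_tendsto_of_tendsto_of_le_of_le tendsto_const_nhds h (fun _ ↦ zero_le)
      fun n ↦ SignedMeasure.totalVariation_toSignedMeasure_sub_le
        (fun _ hE ↦ (σs n).abs_posPart_real_sub_le σ hE) Set.univ
  have hneg := hcont (fun n ↦ (σs n).toJordanDecomposition.negPart)
    σ.toJordanDecomposition.negPart (fun _ ↦ inferInstance) inferInstance <|
    tendsto_of_tendsto_of_tendsto_of_le_of_le tendsto_const_nhds h (fun _ ↦ zero_le)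
      fun n ↦ SignedMeasure.totalVariation_toSignedMeasure_sub_le
        (fun _ hE ↦ (σs n).abs_negPart_real_sub_le σ hE) Set.univ
  have hsum := hpos.add hneg
  rw [add_zero] at hsum
  refine tendsto_of_tendsto_of_tendsto_of_le_of_le tendsto_const_nhds hsum (fun _ ↦ zero_le)
    fun n ↦ ?_
  dsimp only [tilde]
  rw [sub_sub_sub_comm]
  exact SignedMeasure.totalVariation_sub_le _ _ Set.univ
end

section
/- Let (X, Σ_X) and (Y, Σ_Y) be measurable spaces, E a Banach space, C > 0, and let Φ be a transfunction (a map from finite positive measures on (X, Σ_X) to finite positive measures on (Y, Σ_Y)) that is strongly additive (Φ(μ₁ + μ₂) = Φ(μ₁) + Φ(μ₂)), homogeneous (Φ(αμ) = αΦ(μ) for α > 0), and bounded with ‖Φ(μ)‖ ≤ C‖μ‖ for all finite positive measures μ. Suppose vₙ ∈ E and μₙ are finite positive measures on (X, Σ_X) with Σ_{n=1}^∞ ‖vₙ‖ μₙ(X) < ∞ and Σ_{n=1}^∞ μₙ(S) vₙ = 0 for every S ∈ Σ_X. Then Σ_{n=1}^∞ Φ(μₙ)(B) vₙ = 0 for every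 B ∈ Σ_Y. -/
open MeasureTheory Filter
open scoped ENNReal NNReal

/-- A finitely additive map on finite measures that is bounded in total mass is countably
additive. -/
theorem apply_measure_sum_eq_tsum {X Y : Type*} [MeasurableSpace X] [MeasurableSpace Y]
    (C : ℝ≥0) (Φ : Measure X → Measure Y)
    (hadd : ∀ μ₁ μ₂ : Measure X, IsFiniteMeasure μ₁ → IsFiniteMeasure μ₂ →
      Φ (μ₁ + μ₂) = Φ μ₁ + Φ μ₂)
    (hbdd : ∀ μ : Measure X, IsFiniteMeasure μ →
      Φ μ Set.univ ≤ (C : ℝ≥0∞) * μ Set.univ)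
    (ν : ℕ → Measure X) (hν : ∑' n, ν n Set.univ ≠ ∞) (B : Set Y) :
    Φ (Measure.sum ν) B = ∑' n, Φ (ν n) B := by
  have hfin (n : ℕ) : IsFiniteMeasure (ν n) :=
    ⟨(ENNReal.le_tsum n).trans_lt hν.lt_top⟩
  have htail_mass (N : ℕ) : Measure.sum (fun i ↦ ν (i + N)) Set.univ = ∑' i, ν (i + N) Set.univ :=
    Measure.sum_apply _ MeasurableSet.univ
  have htail_fin (N : ℕ) : IsFiniteMeasure (Measure.sum fun i ↦ ν (i + N)) := by
    refine ⟨?_⟩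
    rw [htail_mass]
    exact (ENNReal.tsum_comp_le_tsum_of_injective (add_left_injective N)
      (fun n ↦ ν n Set.univ)).trans_lt hν.lt_top
  have hstep (N : ℕ) : Measure.sum (fun i ↦ ν (i + N)) =
      ν N + Measure.sum (fun i ↦ ν (i + (N + 1))) := by
    ext S hS
    rw [Measure.add_apply, Measure.sum_apply _ hS, Measure.sum_apply _ hS,
      tsum_eq_zero_add' ENNReal.summable]
    simp only [zero_add, add_assoc, add_comm 1 N]
  have hsplit (N : ℕ) : Φ (Measure.sum ν) B =
      ∑ i ∈ Finset.range N, Φ (ν i) B + Φ (Measure.sum fun i ↦ ν (i + N)) B := by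
    induction N with
    | zero => simp
    | succ N ih =>
      rw [ih, hstep N, hadd _ _ (hfin N) (htail_fin (N + 1)), Measure.add_apply,
        Finset.sum_range_succ, add_assoc]
  apply le_antisymm
  · have hlim : Tendsto (fun N ↦ ∑' i, Φ (ν i) B + C * ∑' i, ν (i + N) Set.univ) atTop
        (nhds (∑' i, Φ (ν i) B + C * 0)) :=
      tendsto_const_nhds.add
        (ENNReal.Tendsto.const_mul (ENNReal.tendsto_sum_nat_add _ hν) (.inr ENNReal.coe_ne_top))
    rw [mul_zero, add_zero] at hlim
    refine ge_of_tendsto' hlim fun N ↦ ?_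
    rw [hsplit N]
    gcongr
    · exact ENNReal.sum_le_tsum _
    · rw [← htail_mass]
      exact (measure_mono (Set.subset_univ B)).trans (hbdd _ (htail_fin N))
  · rw [ENNReal.tsum_eq_iSup_nat]
    exact iSup_le fun N ↦ (hsplit N).symm ▸ le_self_add

theorem summable_toReal_smul_of_tsum_ne_top {E : Type*} [NormedAddCommGroup E] [NormedSpace ℝ E]
    [CompleteSpace E] {v : ℕ → E} {m : ℕ → ℝ≥0∞} (h : ∑' n, (‖v n‖₊ : ℝ≥0∞) * m n ≠ ∞) :
    Summable fun n ↦ (m n).toReal • v n := by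
  refine Summable.of_norm ((ENNReal.summable_toReal h).congr fun n ↦ ?_)
  simp [norm_smul, mul_comm]

theorem ofReal_le_nnnorm (b : ℝ) : ENNReal.ofReal b ≤ ‖b‖₊ := by
  rw [← enorm_eq_nnnorm, ← ofReal_norm]
  exact ENNReal.ofReal_le_ofReal (Real.le_norm_self b)

/-- A weighted real series vanishes iff its positive and negative parts have equal sums. -/
theorem tsum_toReal_mul_eq_zero_iff {a : ℕ → ℝ} {m : ℕ → ℝ≥0∞}
    (h : ∑' n, (‖a n‖₊ : ℝ≥0∞) * m n ≠ ∞) :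
    ∑' n, (m n).toReal * a n = 0 ↔
      ∑' n, ENNReal.ofReal (a n) * m n = ∑' n, ENNReal.ofReal (-a n) * m n := by
  have hp : ∑' n, ENNReal.ofReal (a n) * m n ≠ ∞ :=
    ne_top_of_le_ne_top h (ENNReal.tsum_le_tsum fun n ↦ mul_le_mul_left (ofReal_le_nnnorm _) _)
  have hn : ∑' n, ENNReal.ofReal (-a n) * m n ≠ ∞ :=
    ne_top_of_le_ne_top h (ENNReal.tsum_le_tsum fun n ↦
      mul_le_mul_left ((ofReal_le_nnnorm _).trans_eq (by rw [nnnorm_neg])) _)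
  have hdiff : ∑' n, (m n).toReal * a n =
      (∑' n, ENNReal.ofReal (a n) * m n).toReal - (∑' n, ENNReal.ofReal (-a n) * m n).toReal := by
    rw [ENNReal.tsum_toReal_eq (ENNReal.ne_top_of_tsum_ne_top hp),
      ENNReal.tsum_toReal_eq (ENNReal.ne_top_of_tsum_ne_top hn),
      ← (ENNReal.summable_toReal hp).tsum_sub (ENNReal.summable_toReal hn)]
    refine tsum_congr fun n ↦ ?_
    rw [ENNReal.toReal_mul, ENNReal.toReal_mul, ENNReal.toReal_ofReal', ENNReal.toReal_ofReal',
      ← sub_mul, max_zero_sub_max_neg_zero_eq_self, mul_comm]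
  rw [hdiff, sub_eq_zero, ENNReal.toReal_eq_toReal_iff' hp hn]

/-- The scalar case: linear relations between finite measures are preserved. -/
theorem tsum_apply_toReal_mul_eq_zero {X Y : Type*} [MeasurableSpace X] [MeasurableSpace Y]
    (C : ℝ≥0) (Φ : Measure X → Measure Y)
    (hadd : ∀ μ₁ μ₂ : Measure X, IsFiniteMeasure μ₁ → IsFiniteMeasure μ₂ →
      Φ (μ₁ + μ₂) = Φ μ₁ + Φ μ₂)
    (hhom : ∀ (α : ℝ≥0), 0 < α → ∀ μ : Measure X, IsFiniteMeasure μ →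
      Φ (α • μ) = α • Φ μ)
    (hbdd : ∀ μ : Measure X, IsFiniteMeasure μ →
      Φ μ Set.univ ≤ (C : ℝ≥0∞) * μ Set.univ)
    (a : ℕ → ℝ) (μs : ℕ → Measure X) (hfin : ∀ n, IsFiniteMeasure (μs n))
    (hsumX : ∑' n, (‖a n‖₊ : ℝ≥0∞) * μs n Set.univ ≠ ∞)
    (hzero : ∀ S : Set X, MeasurableSet S → ∑' n, (μs n S).toReal * a n = 0)
    (B : Set Y) (hsumY : ∑' n, (‖a n‖₊ : ℝ≥0∞) * Φ (μs n) B ≠ ∞) :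
    ∑' n, (Φ (μs n) B).toReal * a n = 0 := by
  have hsumS (S : Set X) : ∑' n, (‖a n‖₊ : ℝ≥0∞) * μs n S ≠ ∞ :=
    ne_top_of_le_ne_top hsumX (ENNReal.tsum_le_tsum fun n ↦
      mul_le_mul_right (measure_mono (Set.subset_univ S)) _)
  have hΦ0 : Φ 0 = 0 := by
    have h := hbdd 0 inferInstance
    rwa [Measure.coe_zero, Pi.zero_apply, mul_zero, nonpos_iff_eq_zero,
      Measure.measure_univ_eq_zero] at h
  have hsmul (α : ℝ≥0) (n : ℕ) : Φ (α • μs n) = α • Φ (μs n) := by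
    rcases eq_zero_or_pos α with rfl | hα
    · simp [hΦ0]
    · exact hhom α hα _ (hfin n)
  have hpart (b : ℕ → ℝ) (hb : ∀ n, ‖b n‖₊ = ‖a n‖₊) :
      Φ (Measure.sum fun n ↦ (b n).toNNReal • μs n) B =
        ∑' n, ENNReal.ofReal (b n) * Φ (μs n) B := by
    rw [apply_measure_sum_eq_tsum C Φ hadd hbdd]
    · exact tsum_congr fun n ↦ by rw [hsmul]; rfl
    · refine ne_top_of_le_ne_top hsumX (ENNReal.tsum_le_tsum fun n ↦ ?_)
      rw [← hb n]
      exact mul_le_mul_left (ofReal_le_nnnorm _) _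
  rw [tsum_toReal_mul_eq_zero_iff hsumY, ← hpart a fun _ ↦ rfl,
    ← hpart (fun n ↦ -a n) fun _ ↦ nnnorm_neg _]
  congr 2
  ext S hS
  rw [Measure.sum_apply _ hS, Measure.sum_apply _ hS]
  exact (tsum_toReal_mul_eq_zero_iff (hsumS S)).1 (hzero S hS)

/-- Let `Φ` be a bounded (with constant `C`), strongly additive and
homogeneous transfunction and `E` a Banach space.  If `vₙ ∈ E` and `μₙ` are finite
positive measures with `∑ₙ ‖vₙ‖ μₙ(X) < ∞` and `∑ₙ μₙ(S) vₙ = 0` for every `S ∈ Σ_X`,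
then `∑ₙ Φ(μₙ)(B) vₙ = 0` for every `B ∈ Σ_Y`. -/
theorem stmt18 {X Y E : Type*} [MeasurableSpace X] [MeasurableSpace Y]
    [NormedAddCommGroup E] [NormedSpace ℝ E] [CompleteSpace E]
    (C : ℝ≥0) (hC : 0 < C)
    (Φ : Measure X → Measure Y)
    (hΦ : ∀ μ : Measure X, IsFiniteMeasure μ → IsFiniteMeasure (Φ μ))
    (hadd : ∀ μ₁ μ₂ : Measure X, IsFiniteMeasure μ₁ → IsFiniteMeasure μ₂ →
      Φ (μ₁ + μ₂) = Φ μ₁ + Φ μ₂)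
    (hhom : ∀ (α : ℝ≥0), 0 < α → ∀ μ : Measure X, IsFiniteMeasure μ →
      Φ (α • μ) = α • Φ μ)
    (hbdd : ∀ μ : Measure X, IsFiniteMeasure μ →
      Φ μ Set.univ ≤ (C : ℝ≥0∞) * μ Set.univ)
    (v : ℕ → E) (μs : ℕ → Measure X) (hfin : ∀ n, IsFiniteMeasure (μs n))
    (hsum : ∑' n, (‖v n‖₊ : ℝ≥0∞) * μs n Set.univ < ⊤)
    (hzero : ∀ S : Set X, MeasurableSet S → ∑' n, (μs n S).toReal • v n = 0) :
    ∀ B : Set Y, MeasurableSet B → ∑' n, (Φ (μs n) B).toReal • v n = 0 := by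
  intro B _
  have hsumS (S : Set X) : ∑' n, (‖v n‖₊ : ℝ≥0∞) * μs n S ≠ ∞ :=
    ne_top_of_le_ne_top hsum.ne (ENNReal.tsum_le_tsum fun n ↦
      mul_le_mul_right (measure_mono (Set.subset_univ S)) _)
  have hsumY : ∑' n, (‖v n‖₊ : ℝ≥0∞) * Φ (μs n) B ≠ ∞ := by
    refine ne_top_of_le_ne_top (ENNReal.mul_ne_top (ENNReal.coe_ne_top (r := C)) hsum.ne) ?_
    rw [← ENNReal.tsum_mul_left]
    refine ENNReal.tsum_le_tsum fun n ↦ ?_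
    rw [mul_left_comm]
    exact mul_le_mul_right ((measure_mono (Set.subset_univ B)).trans (hbdd _ (hfin n))) _
  have hdual (l : StrongDual ℝ E) {m : ℕ → ℝ≥0∞} (hm : ∑' n, (‖v n‖₊ : ℝ≥0∞) * m n ≠ ∞) :
      ∑' n, (‖l (v n)‖₊ : ℝ≥0∞) * m n ≠ ∞ := by
    refine ne_top_of_le_ne_top (ENNReal.mul_ne_top (ENNReal.coe_ne_top (r := ‖l‖₊)) hm) ?_
    rw [← ENNReal.tsum_mul_left]
    refine ENNReal.tsum_le_tsum fun n ↦ ?_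
    rw [← mul_assoc]
    exact mul_le_mul_left (mod_cast l.le_opNNNorm (v n)) _
  have hmap (l : StrongDual ℝ E) {m : ℕ → ℝ≥0∞} (hm : ∑' n, (‖v n‖₊ : ℝ≥0∞) * m n ≠ ∞) :
      l (∑' n, (m n).toReal • v n) = ∑' n, (m n).toReal * l (v n) := by
    rw [l.map_tsum (summable_toReal_smul_of_tsum_ne_top hm)]
    simp only [map_smul, smul_eq_mul]
  refine SeparatingDual.eq_zero_of_forall_dual_eq_zero (R := ℝ) fun l ↦ ?_
  rw [hmap l hsumY]
  refine tsum_apply_toReal_mul_eq_zero C Φ hadd hhom hbdd (fun n ↦ l (v n)) μs hfin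
    (hdual l hsum.ne) (fun S hS ↦ ?_) B (hdual l hsumY)
  rw [← hmap l (hsumS S), hzero S hS, map_zero]
end
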